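/- Let A be a finite set such that |A| ≥ 13 and |A| is odd. Then the lattice Quo(A) of all quasiorders on A is (1+1+2)-generated: it is generated by a four-element set {x₁, x₂, x₃, x₄} with x₁ < x₂ such that both {x₁, x₃, x₄} and {x₂, x₃, x₄} are antichains. -/

import Mathlib

universe u

open Set

/-- The diagonal (equality) relation on `α`, as a set of pairs. -/
def diagRel (α : Type u) : Set (α × α) := {p | p.1 = p.2}

/-- A quasiorder (preorder): a reflexive and transitive binary relation, as a set of pairs. -/
def IsQuoRel {α : Type u} (r : Set (α × α)) : Prop :=
  (∀ a : α, (a, a) ∈ r) ∧ ∀ a b c : α, (a, b) ∈ r → (b, c) ∈ r → (a, c) ∈ r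

/-- A transitive binary relation, as a set of pairs. -/
def IsTranRel {α : Type u} (r : Set (α × α)) : Prop :=
  ∀ a b c : α, (a, b) ∈ r → (b, c) ∈ r → (a, c) ∈ r

/-- An equivalence relation, as a set of pairs. -/
def IsEquRel {α : Type u} (r : Set (α × α)) : Prop :=
  IsQuoRel r ∧ ∀ p : α × α, p ∈ r → (p.2, p.1) ∈ r

/-- `Quo(α)`: the set of all quasiorders on `α`. -/
def QuoRels (α : Type u) : Set (Set (α × α)) := {r | IsQuoRel r}

/-- `Tran(α)`: the set of all transitive relations on `α`. -/
def TranRels (α : Type u) : Set (Set (α × α)) := {r | IsTranRel r}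

/-- `Equ(α)`: the set of all equivalence relations on `α`. -/
def EquRels (α : Type u) : Set (Set (α × α)) := {r | IsEquRel r}

/-- The least quasiorder containing `r` (the reflexive-transitive closure of `r`). -/
def quoGen {α : Type u} (r : Set (α × α)) : Set (α × α) := ⋂₀ {s | IsQuoRel s ∧ r ⊆ s}

/-- The least transitive relation containing `r` (the transitive closure of `r`). -/
def tranGen {α : Type u} (r : Set (α × α)) : Set (α × α) := ⋂₀ {s | IsTranRel s ∧ r ⊆ s}

/-- The least equivalence relation containing `r`. -/
def equGen {α : Type u} (r : Set (α × α)) : Set (α × α) := ⋂₀ {s | IsEquRel s ∧ r ⊆ s}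

/-- `quo(a,b)`: the least quasiorder containing the pair `(a,b)`. -/
def quoPair {α : Type u} (a b : α) : Set (α × α) := quoGen {(a, b)}

/-- `equ(a,b)`: the least equivalence relation containing the pair `(a,b)`. -/
def equPair {α : Type u} (a b : α) : Set (α × α) := equGen {(a, b)}

/-- The involution: the inverse of a relation. -/
def invRel {α : Type u} (r : Set (α × α)) : Set (α × α) := {p | (p.2, p.1) ∈ r}

/-- `T` is closed under arbitrary (possibly infinite, possibly empty) joins and
meets of the complete lattice `Quo(α)`: the meet of a family of quasiorders is its
intersection and the join is the quasiorder generated by its union. -/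
def QuoClosed {α : Type u} (T : Set (Set (α × α))) : Prop :=
  (∀ S ⊆ T, quoGen (⋃₀ S) ∈ T) ∧ (∀ S ⊆ T, ⋂₀ S ∈ T)

/-- `X` generates the complete lattice `Quo(α)` in the complete sense. -/
def QuoGenerates {α : Type u} (X : Set (Set (α × α))) : Prop :=
  X ⊆ QuoRels α ∧ ∀ T ⊆ QuoRels α, X ⊆ T → QuoClosed T → T = QuoRels α

/-- `T` is closed under arbitrary joins and meets of the complete lattice `Tran(α)`. -/
def TranClosed {α : Type u} (T : Set (Set (α × α))) : Prop :=
  (∀ S ⊆ T, tranGen (⋃₀ S) ∈ T) ∧ (∀ S ⊆ T, ⋂₀ S ∈ T)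

/-- `X` generates the complete lattice `Tran(α)` in the complete sense. -/
def TranGenerates {α : Type u} (X : Set (Set (α × α))) : Prop :=
  X ⊆ TranRels α ∧ ∀ T ⊆ TranRels α, X ⊆ T → TranClosed T → T = TranRels α

/-- `X` generates `Quo(α)` as a complete involution lattice. -/
def QuoInvGenerates {α : Type u} (X : Set (Set (α × α))) : Prop :=
  X ⊆ QuoRels α ∧ ∀ T ⊆ QuoRels α, X ⊆ T → QuoClosed T →
    (∀ r ∈ T, invRel r ∈ T) → T = QuoRels α

/-- `X` generates `Tran(α)` as a complete involution lattice. -/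
def TranInvGenerates {α : Type u} (X : Set (Set (α × α))) : Prop :=
  X ⊆ TranRels α ∧ ∀ T ⊆ TranRels α, X ⊆ T → TranClosed T →
    (∀ r ∈ T, invRel r ∈ T) → T = TranRels α

/-- Incomparability (with respect to inclusion). -/
def Incomp {α : Type u} (a b : Set (α × α)) : Prop := ¬ a ⊆ b ∧ ¬ b ⊆ a

/-- The complete lattice `Quo(α)` is `(1+1+2)`-generated: it is generated, in the
complete sense, by a four-element set `{x₁,x₂,x₃,x₄}` with `x₁ < x₂` such that both
`{x₁,x₃,x₄}` and `{x₂,x₃,x₄}` are antichains. -/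
def QuoOneOneTwoGenerated (α : Type u) : Prop :=
  ∃ x₁ x₂ x₃ x₄ : Set (α × α),
    x₁ ⊂ x₂ ∧ Incomp x₁ x₃ ∧ Incomp x₁ x₄ ∧ Incomp x₂ x₃ ∧ Incomp x₂ x₄ ∧
    Incomp x₃ x₄ ∧ QuoGenerates {x₁, x₂, x₃, x₄}

/-- A cardinal is accessible: it is finite, or it is infinite and every cardinal
`lam ≤ κ` satisfies `lam ≤ 2 ^ μ` for some `μ < lam`, or is at most a sum of fewer
than `lam` many cardinals each smaller than `lam`. -/
def AccessibleCard (κ : Cardinal.{u}) : Prop :=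
  κ < Cardinal.aleph0 ∨
    (Cardinal.aleph0 ≤ κ ∧ ∀ lam : Cardinal.{u}, lam ≤ κ →
      (∃ μ : Cardinal.{u}, μ < lam ∧ lam ≤ 2 ^ μ) ∨
      ∃ (ι : Type u) (f : ι → Cardinal.{u}),
        Cardinal.mk ι < lam ∧ (∀ i : ι, f i < lam) ∧ lam ≤ Cardinal.sum f)
/-- `X` generates the lattice `Quo(α)` (under binary joins and binary meets): the only
subset of `Quo(α)` containing `X` and closed under binary joins and binary meets is
`Quo(α)` itself. -/
def QuoLatGenerates {α : Type u} (X : Set (Set (α × α))) : Prop :=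
  X ⊆ QuoRels α ∧ ∀ T ⊆ QuoRels α, X ⊆ T →
    (∀ a ∈ T, ∀ b ∈ T, quoGen (a ∪ b) ∈ T) →
    (∀ a ∈ T, ∀ b ∈ T, a ∩ b ∈ T) →
    T = QuoRels α
/-- The axioms of the operator sending a relation `R` on `ℕ` to the largest relation below `R`
taken from a fixed lattice of quasiorders. -/
structure IsQuoInterior (I : (ℕ → ℕ → Prop) → ℕ → ℕ → Prop) : Prop where
  mono : ∀ {R S : ℕ → ℕ → Prop} {i j : ℕ}, I R i j → (∀ a b, R a b → S a b) → I S i j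
  inf : ∀ {R S : ℕ → ℕ → Prop} {i j : ℕ}, I R i j → I S i j → I (fun a b => R a b ∧ S a b) i j
  trans : ∀ {R : ℕ → ℕ → Prop} {i j k : ℕ}, (∀ a, R a a) →
    (∀ a b c, R a b → R b c → R a c) → I R i j → I R j k → I R i k

/-- The quasiorder on `ℕ` generated by the arc from `i` to `j`. -/
def ArcRel (i j a b : ℕ) : Prop := a = b ∨ (a = i ∧ b = j)

/-- Having the same parity. -/
def ParityRel (a b : ℕ) : Prop := a % 2 = b % 2

/-- Lying in a common block `{2m - s, 2m + 1 - s}`. -/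
def PairRel (s a b : ℕ) : Prop := (a + s) / 2 = (b + s) / 2

/-- The quasiorder with the two arcs from `0` to `1` and from `5` to `4`. -/
def SeedRel (a b : ℕ) : Prop := a = b ∨ (a = 0 ∧ b = 1) ∨ (a = 5 ∧ b = 4)

namespace IsQuoInterior

variable {I : (ℕ → ℕ → Prop) → ℕ → ℕ → Prop}

lemma dual (h : IsQuoInterior I) : IsQuoInterior fun R i j => I (fun a b => R b a) j i where
  mono h1 h2 := h.mono h1 fun a b => h2 b a
  inf h1 h2 := h.inf h1 h2
  trans hr ht h1 h2 := h.trans hr (fun a b c hab hbc => ht c b a hbc hab) h2 h1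

lemma arc_inf (h : IsQuoInterior I) {R S : ℕ → ℕ → Prop} {i j : ℕ} (h1 : I R i j)
    (h2 : I S i j) (h3 : ∀ a b, R a b → S a b → ArcRel i j a b) : I (ArcRel i j) i j :=
  h.mono (h.inf h1 h2) fun a b hab => h3 a b hab.1 hab.2

/-- An arc is determined by two detours. -/
lemma arc_of_detours (h : IsQuoInterior I) {i j k l : ℕ} (hik : i ≠ k) (hil : i ≠ l)
    (hjk : j ≠ k) (hjl : j ≠ l) (hkl : k ≠ l)
    (h1 : I (ArcRel i k) i k) (h2 : I (ArcRel k j) k j)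
    (h3 : I (ArcRel i l) i l) (h4 : I (ArcRel l j) l j) : I (ArcRel i j) i j := by
  have key : ∀ m, i ≠ m → j ≠ m → I (ArcRel i m) i m → I (ArcRel m j) m j →
      I (fun a b => a = b ∨ (a = i ∧ b = m) ∨ (a = m ∧ b = j) ∨ (a = i ∧ b = j)) i j := by
    intro m him hjm h1 h2
    refine h.trans (j := m) (by simp) (by omega) (h.mono h1 ?_) (h.mono h2 ?_)
    all_goals simp only [ArcRel]; omega
  refine h.arc_inf (key k hik hjk h1 h2) (key l hil hjl h3 h4) ?_
  simp only [ArcRel]; omega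

variable {n : ℕ}

lemma pair_step (h : IsQuoInterior I)
    (hpar : ∀ i j, i < n → j < n → i % 2 = j % 2 → I ParityRel i j)
    (hpair : ∀ s i j, i < n → j < n → (i + s) / 2 = (j + s) / 2 → I (PairRel s) i j)
    {j y : ℕ} (hj : j + 1 < n) (hyj : y + 2 ≤ j) (hpy : y % 2 = j % 2)
    (hjy : I (ArcRel j y) j y) :
    I (fun a b => a = b ∨ (a = j ∧ b = y) ∨ (a = j + 1 ∧ b = y + 1)) (j + 1) (y + 1) := by
  let V : ℕ → ℕ → Prop := fun a b => (a + j) / 2 = (b + j) / 2 ∨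
    ((a + j) / 2 = j ∧ (b + j) / 2 = (y + j) / 2)
  have hr : ∀ a, V a a := fun a => Or.inl rfl
  have ht : ∀ a b c, V a b → V b c → V a c := by simp only [V]; omega
  have e1 : I V (j + 1) j := h.mono (hpair j _ _ hj (by omega) (by omega)) fun a b => Or.inl
  have e2 : I V j y := h.mono hjy (by simp only [V, ArcRel]; omega)
  have e3 : I V y (y + 1) :=
    h.mono (hpair j _ _ (by omega) (by omega) (by omega)) fun a b => Or.inl
  refine h.mono (h.inf (h.trans hr ht e1 (h.trans hr ht e2 e3))
    (hpar (j + 1) (y + 1) hj (by omega) (by omega))) ?_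
  simp only [V, ParityRel]; omega

lemma arc_of_pair_step (h : IsQuoInterior I) {j p q : ℕ}
    (hpj : p + 1 < j) (hpq : p ≠ q) (hqj : q + 1 < j)
    (h1 : I (fun a b => a = b ∨ (a = j ∧ b = p) ∨ (a = j + 1 ∧ b = p + 1)) (j + 1) (p + 1))
    (h2 : I (fun a b => a = b ∨ (a = j ∧ b = q) ∨ (a = j + 1 ∧ b = q + 1)) (j + 1) (q + 1))
    (h3 : I (ArcRel (p + 1) (q + 1)) (p + 1) (q + 1)) :
    I (ArcRel (j + 1) (q + 1)) (j + 1) (q + 1) := by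
  have ht : ∀ a b c, (a = b ∨ (a = j ∧ b = p) ∨ (a = j + 1 ∧ b = p + 1) ∨
      (a = p + 1 ∧ b = q + 1) ∨ (a = j + 1 ∧ b = q + 1)) →
      (b = c ∨ (b = j ∧ c = p) ∨ (b = j + 1 ∧ c = p + 1) ∨
      (b = p + 1 ∧ c = q + 1) ∨ (b = j + 1 ∧ c = q + 1)) →
      (a = c ∨ (a = j ∧ c = p) ∨ (a = j + 1 ∧ c = p + 1) ∨
      (a = p + 1 ∧ c = q + 1) ∨ (a = j + 1 ∧ c = q + 1)) := by
    rintro a b c (rfl | hb | hb | hb | hb) hc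
    · exact hc
    all_goals omega
  refine h.arc_inf (h.trans (by simp) ht (h.mono h1 ?_) (h.mono h3 ?_)) h2 ?_
  · rintro a b (hb | hb | hb) <;> simp [hb]
  · rintro a b (hb | hb) <;> simp [hb]
  · rintro a b (hb | hb | hb | hb | hb) (hc | hc | hc) <;> simp only [ArcRel] <;> omega

lemma arc_down (h : IsQuoInterior I)
    (hpar : ∀ i j, i < n → j < n → i % 2 = j % 2 → I ParityRel i j)
    (hpair : ∀ s i j, i < n → j < n → (i + s) / 2 = (j + s) / 2 → I (PairRel s) i j)
    (hbase : ∀ i j, i < 5 → j < 5 → i ≠ j → I (ArcRel i j) i j) {j : ℕ} (h4 : 4 ≤ j) :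
    j < n → ∀ y < 5, y ≠ j → I (ArcRel j y) j y := by
  induction j, h4 using Nat.le_induction with
  | base => exact fun _ y hy hne => hbase 4 y (by norm_num) hy hne.symm
  | succ j h4 ih =>
    intro hj
    have ih := ih (by omega)
    have step : ∀ y, y < 4 → y % 2 = j % 2 →
        I (fun a b => a = b ∨ (a = j ∧ b = y) ∨ (a = j + 1 ∧ b = y + 1)) (j + 1) (y + 1) :=
      fun y hy hp => h.pair_step hpar hpair hj (by omega) hp (ih y (by omega) (by omega))
    have single : ∀ p q, p < 4 → q < 4 → p % 2 = j % 2 → q % 2 = j % 2 → p ≠ q →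
        I (ArcRel (j + 1) (q + 1)) (j + 1) (q + 1) := fun p q hp hq hpj hqj hpq =>
      h.arc_of_pair_step (by omega) hpq (by omega) (step p hp hpj)
        (step q hq hqj) (hbase (p + 1) (q + 1) (by omega) (by omega) (by omega))
    have h1 := single (j % 2 + 2) (j % 2) (by omega) (by omega) (by omega) (by omega) (by omega)
    have h2 := single (j % 2) (j % 2 + 2) (by omega) (by omega) (by omega) (by omega) (by omega)
    intro y hy hne
    by_cases e1 : y = j % 2 + 1
    · rwa [e1]
    by_cases e2 : y = j % 2 + 2 + 1
    · rwa [e2]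
    exact h.arc_of_detours (k := j % 2 + 1) (l := j % 2 + 2 + 1) (by omega) (by omega) (by omega)
      (by omega) (by omega) h1 (hbase _ _ (by omega) hy (by omega)) h2
      (hbase _ _ (by omega) hy (by omega))

/-- All arcs are obtained as soon as those within `{0, 1, 2, 3, 4}` are. -/
lemma arc_of_base (h : IsQuoInterior I)
    (hpar : ∀ i j, i < n → j < n → i % 2 = j % 2 → I ParityRel i j)
    (hpair : ∀ s i j, i < n → j < n → (i + s) / 2 = (j + s) / 2 → I (PairRel s) i j)
    (hbase : ∀ i j, i < 5 → j < 5 → i ≠ j → I (ArcRel i j) i j) {i j : ℕ} (hi : i < n) (hj : j < n)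
    (hij : i ≠ j) : I (ArcRel i j) i j := by
  have down : ∀ i j, 5 ≤ i → i < n → j < 5 → I (ArcRel i j) i j := fun i j hi5 hi hj =>
    h.arc_down hpar hpair hbase (by omega) hi j hj (by omega)
  have swap : ∀ i j, (fun a b => ArcRel j i b a) = ArcRel i j := by
    intro i j; ext a b; simp only [ArcRel]; omega
  have up : ∀ i j, i < 5 → 5 ≤ j → j < n → I (ArcRel i j) i j := by
    intro i j hi hj5 hj
    have := h.dual.arc_down (n := n) (j := j)
      (fun a b ha hb hab => h.mono (hpar b a hb ha hab.symm) fun _ _ => Eq.symm)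
      (fun s a b ha hb hab => h.mono (hpair s b a hb ha hab.symm) fun _ _ => Eq.symm)
      (fun a b ha hb hab => by simpa only [swap] using hbase b a hb ha hab.symm)
      (by omega) hj i hi (by omega)
    simpa only [swap] using this
  rcases lt_or_ge i 5 with hi5 | hi5 <;> rcases lt_or_ge j 5 with hj5 | hj5
  · exact hbase i j hi5 hj5 hij
  · exact up i j hi5 hj5 hj
  · exact down i j hi5 hi hj5
  · exact h.arc_of_detours (k := 0) (l := 1) (by omega) (by omega) (by omega) (by omega)
      (by omega) (down i 0 hi5 hi (by omega)) (up 0 j (by omega) hj5 hj)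
      (down i 1 hi5 hi (by omega)) (up 1 j (by omega) hj5 hj)

/-- A quasiorder containing nearly all two-step moves within `{0, …, 6}`. -/
def EvenOddRel (a b : ℕ) : Prop :=
  a % 2 = b % 2 ∧ (a / 2 = b / 2 ∨ b / 2 ≤ 2 ∨ (a / 2 = 4 ∧ b / 2 = 3))

lemma evenOddRel (h : IsQuoInterior I) (hn : 7 ≤ n)
    (hpar : ∀ i j, i < n → j < n → i % 2 = j % 2 → I ParityRel i j)
    (hpair : ∀ s i j, i < n → j < n → (i + s) / 2 = (j + s) / 2 → I (PairRel s) i j)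
    (hs₁ : I SeedRel 0 1) (hs₂ : I SeedRel 5 4) :
    I EvenOddRel 2 0 ∧ I EvenOddRel 2 4 ∧ I EvenOddRel 4 2 ∧
      I EvenOddRel 1 3 ∧ I EvenOddRel 3 5 ∧ I EvenOddRel 6 4 := by
  let U₁ : ℕ → ℕ → Prop := fun a b => (a + 1) / 2 = (b + 1) / 2 ∨
    ((a + 1) / 2 = 0 ∧ (b + 1) / 2 = 1) ∨ ((a + 1) / 2 = 3 ∧ (b + 1) / 2 = 2)
  let U₂ : ℕ → ℕ → Prop := fun a b => a / 2 = b / 2 ∨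
    ((a / 2 = 0 ∨ a / 2 = 2 ∨ a / 2 = 3) ∧ b / 2 = 1) ∨ (a / 2 = 3 ∧ b / 2 = 2)
  let U₃ : ℕ → ℕ → Prop := fun a b => (a + 1) / 2 = (b + 1) / 2 ∨
    (b + 1) / 2 = 1 ∨ (b + 1) / 2 = 2 ∨ ((a + 1) / 2 = 4 ∧ (b + 1) / 2 = 3)
  let U₄ : ℕ → ℕ → Prop := fun a b => a / 2 = b / 2 ∨ b / 2 ≤ 2 ∨ (a / 2 = 4 ∧ b / 2 = 3)
  have t₁ : ∀ {i j k}, I U₁ i j → I U₁ j k → I U₁ i k :=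
    h.trans (fun _ => Or.inl rfl) (by simp only [U₁]; omega)
  have t₂ : ∀ {i j k}, I U₂ i j → I U₂ j k → I U₂ i k :=
    h.trans (fun _ => Or.inl rfl) (by simp only [U₂]; omega)
  have t₃ : ∀ {i j k}, I U₃ i j → I U₃ j k → I U₃ i k :=
    h.trans (fun _ => Or.inl rfl) (by simp only [U₃]; omega)
  have t₄ : ∀ {i j k}, I U₄ i j → I U₄ j k → I U₄ i k :=
    h.trans (fun _ => Or.inl rfl) (by simp only [U₄]; omega)
  have γU₁ : ∀ a b, PairRel 1 a b → U₁ a b := by intro a b; simp only [PairRel, U₁]; omega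
  have δU₁ : ∀ a b, SeedRel a b → U₁ a b := by intro a b; simp only [SeedRel, U₁]; omega
  have βU₂ : ∀ a b, PairRel 0 a b → U₂ a b := by intro a b; simp only [PairRel, U₂]; omega
  have γU₃ : ∀ a b, PairRel 1 a b → U₃ a b := by intro a b; simp only [PairRel, U₃]; omega
  have βU₄ : ∀ a b, PairRel 0 a b → U₄ a b := by intro a b; simp only [PairRel, U₄]; omega
  have p₁₂ : ∀ a b, (a % 2 = b % 2 ∧ U₁ a b) → U₂ a b := by
    intro a b; simp only [U₁, U₂]; omega
  have p₂₃ : ∀ a b, (a % 2 = b % 2 ∧ U₂ a b) → U₃ a b := by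
    intro a b; simp only [U₃, U₂]; omega
  have p₃₄ : ∀ a b, (a % 2 = b % 2 ∧ U₃ a b) → U₄ a b := by
    intro a b; simp only [U₃, U₄]; omega
  have γ : ∀ {R : ℕ → ℕ → Prop}, (∀ a b, PairRel 1 a b → R a b) → ∀ i j,
      (i < 7 ∧ j < 7) ∧ (i + 1) / 2 = (j + 1) / 2 → I R i j :=
    fun hR i j hij => h.mono (hpair 1 i j (by omega) (by omega) hij.2) hR
  have β : ∀ {R : ℕ → ℕ → Prop}, (∀ a b, PairRel 0 a b → R a b) → ∀ i j,
      (i < 7 ∧ j < 7) ∧ i / 2 = j / 2 → I R i j :=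
    fun hR i j hij => h.mono (hpair 0 i j (by omega) (by omega) hij.2) hR
  have π : ∀ {R : ℕ → ℕ → Prop} {i j}, I R i j → (i < 7 ∧ j < 7) ∧ i % 2 = j % 2 →
      I (fun a b => a % 2 = b % 2 ∧ R a b) i j := fun hR hij =>
    h.inf (hpar _ _ (by omega) (by omega) hij.2) hR
  have u02 := t₁ (h.mono hs₁ δU₁) (γ γU₁ 1 2 (by norm_num))
  have u53 := t₁ (h.mono hs₂ δU₁) (γ γU₁ 4 3 (by norm_num))
  have u64 := t₁ (γ γU₁ 6 5 (by norm_num)) (h.mono hs₂ δU₁)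
  have q₁ : ∀ {i j}, I U₁ i j → (i < 7 ∧ j < 7) ∧ i % 2 = j % 2 → I U₂ i j :=
    fun hu hij => h.mono (π hu hij) p₁₂
  have u02 := q₁ u02 (by norm_num)
  have u53 := q₁ u53 (by norm_num)
  have u64 := q₁ u64 (by norm_num)
  have u13 := t₂ (β βU₂ 1 0 (by norm_num)) (t₂ u02 (β βU₂ 2 3 (by norm_num)))
  have u42 := t₂ (β βU₂ 4 5 (by norm_num)) (t₂ u53 (β βU₂ 3 2 (by norm_num)))
  have q₂ : ∀ {i j}, I U₂ i j → (i < 7 ∧ j < 7) ∧ i % 2 = j % 2 → I U₃ i j :=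
    fun hu hij => h.mono (π hu hij) p₂₃
  have u02 := q₂ u02 (by norm_num)
  have u64 := q₂ u64 (by norm_num)
  have u13 := q₂ u13 (by norm_num)
  have u42 := q₂ u42 (by norm_num)
  have u24 := t₃ (γ γU₃ 2 1 (by norm_num)) (t₃ u13 (γ γU₃ 3 4 (by norm_num)))
  have u31 := t₃ (γ γU₃ 3 4 (by norm_num)) (t₃ u42 (γ γU₃ 2 1 (by norm_num)))
  have q₃ : ∀ {i j}, I U₃ i j → (i < 7 ∧ j < 7) ∧ i % 2 = j % 2 → I U₄ i j :=
    fun hu hij => h.mono (π hu hij) p₃₄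
  have u64 := q₃ u64 (by norm_num)
  have u13 := q₃ u13 (by norm_num)
  have u42 := q₃ u42 (by norm_num)
  have u24 := q₃ u24 (by norm_num)
  have u31 := q₃ u31 (by norm_num)
  have u35 := t₄ (β βU₄ 3 2 (by norm_num)) (t₄ u24 (β βU₄ 4 5 (by norm_num)))
  have u20 := t₄ (β βU₄ 2 3 (by norm_num)) (t₄ u31 (β βU₄ 1 0 (by norm_num)))
  exact ⟨π u20 (by norm_num), π u24 (by norm_num), π u42 (by norm_num),
    π u13 (by norm_num), π u35 (by norm_num), π u64 (by norm_num)⟩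

/-- All arcs within `{0, …, 6}` lie in a relation that is trivial outside this segment. -/
lemma block (h : IsQuoInterior I) (hn : 7 ≤ n)
    (hpar : ∀ i j, i < n → j < n → i % 2 = j % 2 → I ParityRel i j)
    (hpair : ∀ s i j, i < n → j < n → (i + s) / 2 = (j + s) / 2 → I (PairRel s) i j)
    (hs₁ : I SeedRel 0 1) (hs₂ : I SeedRel 5 4) {i j : ℕ} (hi : i < 7) (hj : j < 7) :
    I (fun a b => a = b ∨ (a < 7 ∧ b < 7)) i j := by
  let B : ℕ → ℕ → Prop := fun a b => a = b ∨ (a < 7 ∧ b < 7)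
  obtain ⟨e20, e24, e42, e13, e35, e64⟩ := h.evenOddRel hn hpar hpair hs₁ hs₂
  have pairs₅ : ∀ i j, i ≤ 5 → j ≤ 5 → i ≠ j → i / 2 = j / 2 → I B i j := by
    let Q : ℕ → ℕ → Prop := fun a b =>
      b ≤ 5 ∨ a = b ∨ (a / 2 = 4 ∧ b / 2 = 3 ∧ a % 2 = b % 2)
    have t : ∀ {i j k}, I Q i j → I Q j k → I Q i k :=
      h.trans (fun _ => Or.inr (Or.inl rfl)) (by simp only [Q]; omega)
    have m : ∀ {i j}, I EvenOddRel i j → I Q i j :=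
      fun hi => h.mono hi (by simp only [EvenOddRel, Q]; omega)
    have s : ∀ {i j}, I SeedRel i j → I Q i j :=
      fun hi => h.mono hi (by simp only [SeedRel, Q]; omega)
    have key : ∀ i j, i ≤ 5 → j ≤ 5 → i ≠ j → i / 2 = j / 2 → I Q i j := by
      intro i j hi hj hne hij
      have : i + 1 = j ∧ (i = 0 ∨ i = 2 ∨ i = 4) ∨ j + 1 = i ∧ (j = 0 ∨ j = 2 ∨ j = 4) := by omega
      rcases this with ⟨rfl, rfl | rfl | rfl⟩ | ⟨rfl, rfl | rfl | rfl⟩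
      · exact s hs₁
      · exact t (m e20) (t (s hs₁) (m e13))
      · exact t (m e42) (t (m e20) (t (s hs₁) (t (m e13) (m e35))))
      · exact t (m e13) (t (m e35) (t (s hs₂) (t (m e42) (m e20))))
      · exact t (m e35) (t (s hs₂) (m e42))
      · exact s hs₂
    intro i j hi hj hne hij
    refine h.mono (h.inf (key i j hi hj hne hij) (hpair 0 i j (by omega) (by omega) hij)) ?_
    simp only [Q, PairRel, B]; omega
  have pairs₆ : ∀ i j, i ≤ 6 → j ≤ 6 → i ≠ j → (i + 1) / 2 = (j + 1) / 2 → I B i j := by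
    let U : ℕ → ℕ → Prop := fun a b => (b + 1) / 2 ≤ 3 ∨ (a + 1) / 2 = (b + 1) / 2 ∨
      ((a + 1) / 2 = 5 ∧ (b + 1) / 2 = 4)
    have tU : ∀ {i j k}, I U i j → I U j k → I U i k :=
      h.trans (fun _ => Or.inr (Or.inl rfl)) (by simp only [U]; omega)
    have mU : ∀ {i j}, I EvenOddRel i j → I U i j :=
      fun hi => h.mono hi (by simp only [EvenOddRel, U]; omega)
    have gU : ∀ i j, (i < 7 ∧ j < 7) ∧ (i + 1) / 2 = (j + 1) / 2 → I U i j := fun i j hij =>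
      h.mono (hpair 1 i j (by omega) (by omega) hij.2) (by simp only [PairRel, U]; omega)
    let Q : ℕ → ℕ → Prop := fun a b =>
      b ≤ 6 ∨ a = b ∨ ((a + 1) / 2 = 5 ∧ (b + 1) / 2 = 4 ∧ a % 2 = b % 2)
    have t : ∀ {i j k}, I Q i j → I Q j k → I Q i k :=
      h.trans (fun _ => Or.inr (Or.inl rfl)) (by simp only [Q]; omega)
    have m : ∀ {i j}, (i < n ∧ j < n) ∧ i % 2 = j % 2 → I U i j → I Q i j := fun hij hi =>
      h.mono (h.inf hi (hpar _ _ hij.1.1 hij.1.2 hij.2)) (by simp only [ParityRel, U, Q]; omega)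
    have s : ∀ {i j}, I SeedRel i j → I Q i j :=
      fun hi => h.mono hi (by simp only [SeedRel, Q]; omega)
    have e46 := m (by omega) (tU (gU 4 3 (by norm_num)) (tU (mU e35) (gU 5 6 (by norm_num))))
    have e20 := m (by omega) (mU e20)
    have e24 := m (by omega) (mU e24)
    have e42 := m (by omega) (mU e42)
    have e13 := m (by omega) (mU e13)
    have e35 := m (by omega) (mU e35)
    have e64 := m (by omega) (mU e64)
    have e41 := t e42 (t e20 (s hs₁))
    have key : ∀ i j, i ≤ 6 → j ≤ 6 → i ≠ j → (i + 1) / 2 = (j + 1) / 2 → I Q i j := by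
      intro i j hi hj hne hij
      have : i + 1 = j ∧ (i = 1 ∨ i = 3 ∨ i = 5) ∨ j + 1 = i ∧ (j = 1 ∨ j = 3 ∨ j = 5) := by omega
      rcases this with ⟨rfl, rfl | rfl | rfl⟩ | ⟨rfl, rfl | rfl | rfl⟩
      · exact t e13 (t e35 (t (s hs₂) e42))
      · exact t e35 (s hs₂)
      · exact t (s hs₂) e46
      · exact t e24 e41
      · exact t e41 e13
      · exact t e64 (t e41 (t e13 e35))
    intro i j hi hj hne hij
    refine h.mono (h.inf (key i j hi hj hne hij) (hpair 1 i j (by omega) (by omega) hij)) ?_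
    simp only [Q, PairRel, B]; omega
  have t : ∀ {i j k}, I B i j → I B j k → I B i k :=
    h.trans (fun _ => Or.inl rfl) (by simp only [B]; omega)
  have adj : ∀ i j, i < 7 → j < 7 → (j = i + 1 ∨ i = j + 1) → I B i j := by
    intro i j hi hj hij
    rcases Nat.mod_two_eq_zero_or_one (min i j) with hm | hm
    · exact pairs₅ i j (by omega) (by omega) (by omega) (by omega)
    · exact pairs₆ i j (by omega) (by omega) (by omega) (by omega)
  have up : ∀ i d, i + d + 1 < 7 → I B i (i + d + 1) ∧ I B (i + d + 1) i := by
    intro i d hd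
    induction d with
    | zero => exact ⟨adj _ _ (by omega) hd (by omega), adj _ _ hd (by omega) (by omega)⟩
    | succ d ih =>
      have ih := ih (by omega)
      exact ⟨t ih.1 (adj _ _ (by omega) hd (by omega)), t (adj _ _ hd (by omega) (by omega)) ih.2⟩
  have via0 : ∀ i, i < 7 → I B i 0 ∧ I B 0 i := by
    intro i hi
    match i with
    | 0 => exact ⟨t (up 0 0 (by norm_num)).1 (up 0 0 (by norm_num)).2,
        t (up 0 0 (by norm_num)).1 (up 0 0 (by norm_num)).2⟩
    | d + 1 => simpa using (up 0 d (by omega)).symm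
  exact t (via0 i hi).1 (via0 j hj).2

end IsQuoInterior
/-- The reflexive relation on `ℕ` whose arcs within `{0, …, 6}` are the bits of `r`. -/
def MaskRel (r x y : ℕ) : Prop := x = y ∨ (x < 7 ∧ y < 7 ∧ r.testBit (7 * x + y) = true)

/-- The code of the full relation on `{0, …, 6}`. -/
def fullMask : ℕ := 2 ^ 49 - 1

/-- Adds to the relation coded by `r` all composites of two arcs meeting in `k`. -/
def shortcut (r k : ℕ) : ℕ :=
  r ||| ((r >>> k) &&& 4432676798593) * ((r >>> (7 * k)) &&& 127)

def IsTransMask (r : ℕ) : Prop := ∀ x < 7, ∀ y < 7, r.testBit (7 * x + y) = true →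
  ∀ z < 7, r.testBit (7 * y + z) = true → r.testBit (7 * x + z) = true

instance (r : ℕ) : Decidable (IsTransMask r) := by unfold IsTransMask; infer_instance

/-- A code of the transitive closure of the relation coded by `r`. -/
def closeMask (r : ℕ) : ℕ :=
  let t := [0, 1, 2, 3, 4, 5, 6].foldl shortcut r
  if IsTransMask t then t else fullMask

lemma testBit_fullMask {k : ℕ} (hk : k < 49) : fullMask.testBit k = true := by
  rw [fullMask, Nat.testBit_two_pow_sub_one]
  exact decide_eq_true hk

lemma isTransMask_closeMask (r : ℕ) : IsTransMask (closeMask r) := by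
  unfold closeMask
  dsimp only
  split_ifs with h
  · exact h
  · intro x hx y hy _ z hz _
    exact testBit_fullMask (by omega)

lemma testBit_foldl_shortcut {k : ℕ} (l : List ℕ) {r : ℕ} (hr : r.testBit k = true) :
    (l.foldl shortcut r).testBit k = true := by
  induction l generalizing r with
  | nil => exact hr
  | cons a l ih => exact ih (by simp [shortcut, hr])

lemma maskRel_closeMask {r x y : ℕ} (h : MaskRel r x y) : MaskRel (closeMask r) x y := by
  refine h.imp_right fun ⟨hx, hy, h⟩ => ⟨hx, hy, ?_⟩
  unfold closeMask
  dsimp only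
  split_ifs
  · exact testBit_foldl_shortcut _ h
  · exact testBit_fullMask (by omega)

lemma maskRel_trans {r : ℕ} (hr : IsTransMask r) (x y z : ℕ) :
    MaskRel r x y → MaskRel r y z → MaskRel r x z := by
  rintro (rfl | ⟨hx, hy, h1⟩) (rfl | ⟨hy', hz, h2⟩)
  · exact Or.inl rfl
  · exact Or.inr ⟨hy', hz, h2⟩
  · exact Or.inr ⟨hx, hy, h1⟩
  · exact Or.inr ⟨hx, hz, hr x hx y hy h1 z hz h2⟩

/-- The relation on `{0, …, 6}` known initially to contain the arc from `i` to `j`. -/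
def StartRel (i j x y : ℕ) : Prop :=
  (i % 2 = j % 2 → ParityRel x y) ∧ (i / 2 = j / 2 → PairRel 0 x y) ∧
    ((i + 1) / 2 = (j + 1) / 2 → PairRel 1 x y) ∧
    ((i = 0 ∧ j = 1) ∨ (i = 5 ∧ j = 4) → SeedRel x y)

instance (i j x y : ℕ) : Decidable (StartRel i j x y) := by
  unfold StartRel ParityRel PairRel SeedRel; infer_instance

/-- The code of the restriction of `StartRel i j` to `{0, …, 6}`. -/
def startMask (i j : ℕ) : ℕ :=
  ((List.range 49).filter fun k => StartRel i j (k / 7) (k % 7)).foldl (fun r k => r + 2 ^ k) 0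

instance (i j x y : ℕ) : Decidable (ArcRel i j x y) := by
  unfold ArcRel; infer_instance

/-- The codes of all `StartRel i j`, listed in the order of `7 * i + j`. -/
def startTable : List ℕ := (List.range 49).map fun k => startMask (k / 7) (k % 7)

/-- Cuts down the entry for the arc from `a` to `b` by the detour through `c`. -/
def cutTable (m : List ℕ) : Fin 7 × Fin 7 × Fin 7 → List ℕ
  | (a, c, b) => m.set (7 * a + b)
      (m.getD (7 * a + b) 0 &&& closeMask (m.getD (7 * a + c) 0 ||| m.getD (7 * c + b) 0))

/-- A sequence of detours cutting the entries for all arcs within `{0, …, 4}` down to single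
arcs. -/
def detours : List (Fin 7 × Fin 7 × Fin 7) :=
  [(5, 4, 3), (0, 1, 2), (1, 0, 2), (6, 5, 4), (4, 5, 3), (4, 3, 2), (3, 4, 2), (5, 4, 2),
   (6, 4, 3), (5, 3, 2), (1, 2, 3), (2, 1, 3), (5, 2, 1), (2, 3, 4), (0, 1, 3), (6, 5, 2),
   (0, 2, 3), (5, 1, 0), (2, 4, 5), (3, 2, 5), (6, 2, 3), (4, 5, 0), (4, 6, 3), (4, 2, 3),
   (0, 6, 3), (0, 3, 1), (2, 6, 3), (2, 3, 1), (2, 1, 0), (0, 3, 4), (2, 3, 4), (4, 3, 5),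
   (0, 1, 2), (2, 0, 4), (3, 2, 1), (2, 4, 0), (4, 5, 1), (2, 4, 3), (1, 2, 0), (2, 0, 1),
   (1, 2, 3), (3, 4, 5), (0, 1, 3), (0, 2, 3), (3, 5, 4), (1, 3, 2), (3, 1, 2), (3, 1, 0),
   (1, 2, 4), (1, 3, 4), (2, 1, 0), (3, 2, 1), (0, 3, 4), (4, 3, 2), (2, 1, 4), (4, 2, 1),
   (4, 1, 0), (3, 4, 0)]

lemma testBit_startTable : ∀ i < 7, ∀ j < 7, ∀ x < 7, ∀ y < 7, StartRel i j x y →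
    (startTable.getD (7 * i + j) 0).testBit (7 * x + y) = true := by
  decide +kernel

lemma arc_of_testBit_detours : ∀ i < 5, ∀ j < 5, ∀ x < 7, ∀ y < 7,
    ((detours.foldl cutTable startTable).getD (7 * i + j) 0).testBit (7 * x + y) = true →
      ArcRel i j x y := by
  decide +kernel

namespace IsQuoInterior

variable {I : (ℕ → ℕ → Prop) → ℕ → ℕ → Prop} {n : ℕ}

lemma startTable (h : IsQuoInterior I) (hn : 7 ≤ n)
    (hpar : ∀ i j, i < n → j < n → i % 2 = j % 2 → I ParityRel i j)
    (hpair : ∀ s i j, i < n → j < n → (i + s) / 2 = (j + s) / 2 → I (PairRel s) i j)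
    (hs₁ : I SeedRel 0 1) (hs₂ : I SeedRel 5 4) (i j : Fin 7) :
    I (MaskRel (startTable.getD (7 * i + j) 0)) i j := by
  have hi : (i : ℕ) < n := i.2.trans_le hn
  have hj : (j : ℕ) < n := j.2.trans_le hn
  have hB := h.block hn hpar hpair hs₁ hs₂ i.2 j.2
  have cond : ∀ {p : Prop} {R : ℕ → ℕ → Prop}, (p → I R i j) → I (fun a b => p → R a b) i j := by
    intro p R hR
    by_cases hp : p
    · exact h.mono (hR hp) fun _ _ hab _ => hab
    · exact h.mono hB fun _ _ _ hp' => absurd hp' hp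
  have hS : I (fun a b => (a = b ∨ (a < 7 ∧ b < 7)) ∧ StartRel i j a b) i j := by
    refine h.inf hB (h.inf (cond (hpar _ _ hi hj)) (h.inf (cond (hpair 0 _ _ hi hj))
      (h.inf (cond (hpair 1 _ _ hi hj)) (cond ?_))))
    rintro (⟨e1, e2⟩ | ⟨e1, e2⟩) <;> rw [e1, e2] <;> assumption
  exact h.mono hS fun a b ⟨hab, hst⟩ => hab.imp_right fun ⟨ha, hb⟩ =>
    ⟨ha, hb, testBit_startTable i i.2 j j.2 a ha b hb hst⟩

lemma cutTable (h : IsQuoInterior I) {m : List ℕ}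
    (hm : ∀ i j : Fin 7, I (MaskRel (m.getD (7 * i + j) 0)) i j) (s : Fin 7 × Fin 7 × Fin 7)
    (i j : Fin 7) : I (MaskRel ((cutTable m s).getD (7 * i + j) 0)) i j := by
  obtain ⟨a, c, b⟩ := s
  by_cases hij : 7 * (a : ℕ) + b = 7 * i + j
  · obtain rfl : a = i := by omega
    obtain rfl : b = j := by omega
    have hc : I (MaskRel (closeMask (m.getD (7 * a + c) 0 ||| m.getD (7 * c + b) 0))) a b := by
      refine h.trans (j := c) (fun _ => Or.inl rfl) (maskRel_trans (isTransMask_closeMask _))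
        (h.mono (hm a c) fun x y hxy => maskRel_closeMask ?_)
        (h.mono (hm c b) fun x y hxy => maskRel_closeMask ?_)
      all_goals exact hxy.imp_right fun ⟨hx, hy, hxy⟩ => ⟨hx, hy, by
        simp only [Nat.testBit_or, hxy, Bool.true_or, Bool.or_true]⟩
    refine h.mono (h.inf (hm a b) hc) fun x y ⟨h1, h2⟩ => ?_
    rcases h1 with h1 | ⟨hx, hy, h1⟩
    · exact Or.inl h1
    rcases h2 with h2 | ⟨-, -, h2⟩
    · exact Or.inl h2
    have hl : 7 * (a : ℕ) + b < m.length := by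
      by_contra hl
      simp [List.getD_eq_getElem?_getD, List.getElem?_eq_none (not_lt.1 hl)] at h1
    refine Or.inr ⟨hx, hy, ?_⟩
    rw [_root_.cutTable, List.getD_eq_getElem?_getD, List.getElem?_set_self hl, Option.getD_some,
      Nat.testBit_and, h1, h2, Bool.and_true]
  · rw [_root_.cutTable, List.getD_eq_getElem?_getD, List.getElem?_set_ne hij,
      ← List.getD_eq_getElem?_getD]
    exact hm i j

lemma foldl_cutTable (h : IsQuoInterior I) (l : List (Fin 7 × Fin 7 × Fin 7)) {m : List ℕ}
    (hm : ∀ i j : Fin 7, I (MaskRel (m.getD (7 * i + j) 0)) i j) (i j : Fin 7) :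
    I (MaskRel ((l.foldl _root_.cutTable m).getD (7 * i + j) 0)) i j := by
  induction l generalizing m with
  | nil => exact hm i j
  | cons s l ih => exact ih (h.cutTable hm s)

/-- The generators yield all arcs. -/
lemma arc (h : IsQuoInterior I) (hn : 7 ≤ n)
    (hpar : ∀ i j, i < n → j < n → i % 2 = j % 2 → I ParityRel i j)
    (hpair : ∀ s i j, i < n → j < n → (i + s) / 2 = (j + s) / 2 → I (PairRel s) i j)
    (hs₁ : I SeedRel 0 1) (hs₂ : I SeedRel 5 4) {i j : ℕ} (hi : i < n) (hj : j < n)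
    (hij : i ≠ j) : I (ArcRel i j) i j := by
  refine h.arc_of_base hpar hpair (fun i j hi hj _ => ?_) hi hj hij
  refine h.mono (h.foldl_cutTable detours (h.startTable hn hpar hpair hs₁ hs₂)
    ⟨i, by omega⟩ ⟨j, by omega⟩) ?_
  rintro a b (rfl | ⟨ha, hb, hab⟩)
  · exact Or.inl rfl
  · exact arc_of_testBit_detours i hi j hj a ha b hb hab

end IsQuoInterior

section Assembly

variable {α : Type u}

lemma isQuoRel_quoGen (r : Set (α × α)) : IsQuoRel (quoGen r) :=
  ⟨fun a _ hs => hs.1.1 a, fun a b c hab hbc s hs => hs.1.2 a b c (hab s hs) (hbc s hs)⟩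

lemma subset_quoGen (r : Set (α × α)) : r ⊆ quoGen r := fun _ hp _ hs => hs.2 hp

lemma quoGen_subset {r s : Set (α × α)} (hs : IsQuoRel s) (h : r ⊆ s) : quoGen r ⊆ s :=
  fun _ hp => hp s ⟨hs, h⟩

/-- The relation on `α` induced by a relation on `ℕ` through a numbering. -/
def pullRel (f : α → ℕ) (R : ℕ → ℕ → Prop) : Set (α × α) := {p | R (f p.1) (f p.2)}

lemma isQuoRel_pullRel (f : α → ℕ) {R : ℕ → ℕ → Prop} (hr : ∀ a, R a a)
    (ht : ∀ a b c, R a b → R b c → R a c) : IsQuoRel (pullRel f R) :=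
  ⟨fun _ => hr _, fun _ _ _ => ht _ _ _⟩

/-- Some member of `T` below the relation induced by `R` contains the arc numbered `(i, j)`. -/
def Interior (f : α → ℕ) (T : Set (Set (α × α))) (R : ℕ → ℕ → Prop) (i j : ℕ) : Prop :=
  ∃ t ∈ T, (∃ x y, f x = i ∧ f y = j ∧ (x, y) ∈ t) ∧ t ⊆ pullRel f R

variable {f : α → ℕ} {T : Set (Set (α × α))}

lemma isQuoInterior_interior (hf : Function.Injective f)
    (hjoin : ∀ a ∈ T, ∀ b ∈ T, quoGen (a ∪ b) ∈ T) (hmeet : ∀ a ∈ T, ∀ b ∈ T, a ∩ b ∈ T) :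
    IsQuoInterior (Interior f T) where
  mono := fun ⟨t, ht, hij, hR⟩ h => ⟨t, ht, hij, hR.trans fun _ => h _ _⟩
  inf := by
    rintro R S _ _ ⟨t, ht, ⟨x, y, rfl, rfl, hxy⟩, hR⟩ ⟨s, hs, ⟨x', y', hx, hy, hxy'⟩, hS⟩
    obtain rfl := hf hx
    obtain rfl := hf hy
    exact ⟨t ∩ s, hmeet t ht s hs, ⟨x', y', rfl, rfl, hxy, hxy'⟩, fun p hp => ⟨hR hp.1, hS hp.2⟩⟩
  trans := by
    rintro R _ _ _ hr htr ⟨t, ht, ⟨x, y, rfl, rfl, hxy⟩, hR⟩ ⟨s, hs, ⟨y', z, hy, rfl, hyz⟩, hS⟩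
    obtain rfl := hf hy
    refine ⟨quoGen (t ∪ s), hjoin t ht s hs, ⟨x, z, rfl, rfl, ?_⟩,
      quoGen_subset (isQuoRel_pullRel f hr htr) (union_subset hR hS)⟩
    exact (isQuoRel_quoGen _).2 x y' z (subset_quoGen _ (Or.inl hxy)) (subset_quoGen _ (Or.inr hyz))

lemma interior_pullRel {R : ℕ → ℕ → Prop} (hR : pullRel f R ∈ T) {i j : ℕ} (hi : i ∈ range f)
    (hj : j ∈ range f) (hij : R i j) : Interior f T R i j := by
  obtain ⟨x, rfl⟩ := hi
  obtain ⟨y, rfl⟩ := hj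
  exact ⟨_, hR, ⟨x, y, rfl, rfl, hij⟩, Subset.rfl⟩

/-- A sublattice of `Quo(α)` containing all arcs and the equality relation is all of `Quo(α)`. -/
lemma eq_quoRels_of_interior [Finite α] (hf : Function.Injective f) (hT : T ⊆ QuoRels α)
    (hjoin : ∀ a ∈ T, ∀ b ∈ T, quoGen (a ∪ b) ∈ T) (hdiag : diagRel α ∈ T)
    (harc : ∀ x y : α, x ≠ y → Interior f T (ArcRel (f x) (f y)) (f x) (f y)) :
    T = QuoRels α := by
  refine hT.antisymm fun r hr => ?_
  have key : ∀ S : Set (α × α), S.Finite → S ⊆ r → ∃ t ∈ T, S ⊆ t ∧ t ⊆ r := by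
    intro S hS
    induction S, hS using Set.Finite.induction_on with
    | empty =>
      refine fun _ => ⟨_, hdiag, empty_subset _, ?_⟩
      rintro ⟨x, y⟩ (rfl : x = y)
      exact hr.1 x
    | @insert p S _ _ ih =>
      intro hpS
      obtain ⟨t, ht, hSt, htr⟩ := ih ((subset_insert p S).trans hpS)
      obtain ⟨x, y⟩ := p
      have hxy : (x, y) ∈ r := hpS (mem_insert _ _)
      by_cases hne : x = y
      · exact ⟨t, ht, insert_subset (hne ▸ (hT ht).1 x) hSt, htr⟩
      obtain ⟨s, hs, ⟨x', y', hx, hy, hs'⟩, hsr⟩ := harc x y hne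
      obtain rfl := hf hx
      obtain rfl := hf hy
      have hsr' : s ⊆ r := by
        rintro ⟨a, b⟩ hab
        rcases hsr hab with h | ⟨h1, h2⟩
        · obtain rfl : a = b := hf h
          exact hr.1 a
        · obtain rfl : a = x' := hf h1
          obtain rfl : b = y' := hf h2
          exact hxy
      refine ⟨quoGen (s ∪ t), hjoin s hs t ht, insert_subset (subset_quoGen _ (Or.inl hs')) ?_,
        quoGen_subset hr (union_subset hsr' htr)⟩
      exact (hSt.trans subset_union_right).trans (subset_quoGen _)
  obtain ⟨t, ht, hrt, htr⟩ := key r r.toFinite Subset.rfl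
  exact htr.antisymm hrt ▸ ht

lemma quoLatGenerates_pullRel [Finite α] {n : ℕ} (hn : 7 ≤ n) (hf : Function.Injective f)
    (hrange : ∀ i, i ∈ range f ↔ i < n) : QuoLatGenerates
      {pullRel f SeedRel, pullRel f (PairRel 0), pullRel f ParityRel, pullRel f (PairRel 1)} := by
  have hpair : ∀ s, IsQuoRel (pullRel f (PairRel s)) := fun s =>
    isQuoRel_pullRel f (fun _ => rfl) fun _ _ _ => Eq.trans
  refine ⟨?_, fun T hT hX hjoin hmeet => ?_⟩
  · rintro _ (rfl | rfl | rfl | rfl)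
    · exact isQuoRel_pullRel f (fun _ => Or.inl rfl) (by simp only [SeedRel]; omega)
    · exact hpair 0
    · exact isQuoRel_pullRel f (fun _ => rfl) fun _ _ _ => Eq.trans
    · exact hpair 1
  have hI := isQuoInterior_interior hf hjoin hmeet
  have hpar : ∀ i j, i < n → j < n → i % 2 = j % 2 → Interior f T ParityRel i j := fun i j hi hj =>
    interior_pullRel (R := ParityRel) (hX (by simp)) ((hrange i).2 hi) ((hrange j).2 hj)
  have hpairI : ∀ s i j, i < n → j < n → (i + s) / 2 = (j + s) / 2 →
      Interior f T (PairRel s) i j := by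
    intro s i j hi hj hij
    have hs : pullRel f (PairRel s) ∈ T := by
      rcases Nat.even_or_odd' s with ⟨k, rfl | rfl⟩
      · have : PairRel (2 * k) = PairRel 0 := by
          ext a b; simp only [PairRel]; omega
        rw [this]
        exact hX (by simp)
      · have : PairRel (2 * k + 1) = PairRel 1 := by
          ext a b; simp only [PairRel]; omega
        rw [this]
        exact hX (by simp)
    exact interior_pullRel hs ((hrange i).2 hi) ((hrange j).2 hj) hij
  have hseed : ∀ i j, i < n → j < n → SeedRel i j → Interior f T SeedRel i j := fun i j hi hj =>
    interior_pullRel (R := SeedRel) (hX (by simp)) ((hrange i).2 hi) ((hrange j).2 hj)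
  have lt : ∀ x, f x < n := fun x => (hrange _).1 (mem_range_self x)
  have harc : ∀ x y : α, x ≠ y → Interior f T (ArcRel (f x) (f y)) (f x) (f y) := fun x y hxy =>
    hI.arc hn hpar hpairI (hseed 0 1 (by omega) (by omega) (by simp [SeedRel]))
      (hseed 5 4 (by omega) (by omega) (by simp [SeedRel])) (lt x) (lt y) (hf.ne hxy)
  refine eq_quoRels_of_interior hf hT hjoin ?_ harc
  obtain ⟨x, hx⟩ := (hrange 0).2 (by omega)
  have hβγ : pullRel f (PairRel 0) ∩ pullRel f (PairRel 1) = diagRel α := by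
    ext ⟨a, b⟩
    constructor
    · rintro ⟨h1, h2⟩
      simp only [pullRel, PairRel, mem_ofPred_eq] at h1 h2
      exact hf (show f a = f b by omega)
    · rintro (rfl : a = b)
      exact ⟨rfl, rfl⟩
  exact hβγ ▸ hmeet _ (hX (by simp)) _ (hX (by simp))

lemma not_pullRel_subset {R S : ℕ → ℕ → Prop} {i j : ℕ} (hi : i ∈ range f) (hj : j ∈ range f)
    (h1 : R i j) (h2 : ¬ S i j) : ¬ pullRel f R ⊆ pullRel f S := by
  obtain ⟨x, rfl⟩ := hi
  obtain ⟨y, rfl⟩ := hj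
  exact fun h => h2 (h (show (x, y) ∈ pullRel f R from h1))

end Assembly

/-- If `A` is finite with `|A| ≥ 13` odd, then the lattice `Quo(A)` is
`(1+1+2)`-generated: it is generated by a four-element set `{x₁,x₂,x₃,x₄}` with
`x₁ < x₂` such that `{x₁,x₃,x₄}` and `{x₂,x₃,x₄}` are antichains. -/
theorem quo_one_one_two_generated_finite_odd {α : Type u} [Finite α]
    (h13 : 13 ≤ Nat.card α) (hodd : Odd (Nat.card α)) :
    ∃ x₁ x₂ x₃ x₄ : Set (α × α),
      x₁ ⊂ x₂ ∧ Incomp x₁ x₃ ∧ Incomp x₁ x₄ ∧ Incomp x₂ x₃ ∧ Incomp x₂ x₄ ∧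
      Incomp x₃ x₄ ∧ QuoLatGenerates {x₁, x₂, x₃, x₄} := by
  let f : α → ℕ := fun x => Finite.equivFin α x
  have hf : Function.Injective f := fun x y hxy => (Finite.equivFin α).injective (Fin.ext hxy)
  have hrange : ∀ i, i ∈ range f ↔ i < Nat.card α := fun i =>
    ⟨by rintro ⟨x, rfl⟩; exact (Finite.equivFin α x).2,
      fun hi => ⟨(Finite.equivFin α).symm ⟨i, hi⟩, by simp [f]⟩⟩
  have hns : ∀ {R S : ℕ → ℕ → Prop} (i j : ℕ), i < 7 ∧ j < 7 ∧ R i j ∧ ¬ S i j →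
      ¬ pullRel f R ⊆ pullRel f S := fun i j ⟨hi, hj, hR, hS⟩ =>
    not_pullRel_subset ((hrange i).2 (by omega)) ((hrange j).2 (by omega)) hR hS
  refine ⟨_, _, _, _, ⟨?_, hns 2 3 ?_⟩, ⟨hns 0 1 ?_, hns 0 2 ?_⟩, ⟨hns 0 1 ?_, hns 1 2 ?_⟩,
    ⟨hns 0 1 ?_, hns 0 2 ?_⟩, ⟨hns 0 1 ?_, hns 1 2 ?_⟩, ⟨hns 0 2 ?_, hns 1 2 ?_⟩,
    quoLatGenerates_pullRel (by omega) hf hrange⟩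
  · intro p
    simp only [pullRel, SeedRel, PairRel, mem_ofPred_eq]
    omega
  all_goals simp [SeedRel, PairRel, ParityRel]
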